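/- Let μ, ν ∈ ℝ, set λ = 2(ν−μ), and let h : [0,∞) → ℝ be bounded and continuous. Define v(t,x) = ∫₀^∞ ∫_{−∞}^{s} e^{−λ(max(x,s)−x)} h(max(x,s) − b) g(t;b,s) db ds for t > 0 and x ≥ 0, and v(0,x) = h(x). Then v is infinitely differentiable on (0,∞) × [0,∞) (one-sided derivatives in x at x = 0) and satisfies: v_t(t,x) = μ v_x(t,x) + (1/2) v_xx(t,x) for all t > 0 and x ≥ 0; v_x(t,0) = λ v(t,0) for all t > 0; and v(t,x) → h(x) as t ↓ 0 for every x ≥ 0. -/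

import Mathlib

open MeasureTheory Set Filter

/-- Standard normal density. -/
noncomputable def phi (x : ℝ) : ℝ := (1 / Real.sqrt (2 * Real.pi)) * Real.exp (-x ^ 2 / 2)

/-- Standard normal tail function. -/
noncomputable def Psi (x : ℝ) : ℝ := ∫ y in Set.Ioi x, phi y

/-- The kernel `G(t;x,y)` with drift parameter `μ`. -/
noncomputable def Gker (μ t x y : ℝ) : ℝ :=
  (1 / Real.sqrt t) *
      (Real.exp (2 * μ * y) * phi ((x + y + μ * t) / Real.sqrt t) +
        phi ((x - y + μ * t) / Real.sqrt t)) -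
    2 * μ * Real.exp (2 * μ * y) * Psi ((x + y + μ * t) / Real.sqrt t)

/-- The kernel `H(t;x,y)` with parameters `μ, ν`. -/
noncomputable def Hker (μ ν t x y : ℝ) : ℝ :=
  if ν = μ then
    2 * Real.exp (2 * μ * y) *
      ((1 + μ * (x + y + μ * t)) * Psi ((x + y + μ * t) / Real.sqrt t) -
        μ * Real.sqrt t * phi ((x + y + μ * t) / Real.sqrt t))
  else
    Real.exp (2 * μ * y) / (ν - μ) *
      ((2 * ν - μ) * Real.exp (2 * (ν - μ) * (x + y + ν * t)) *
          Psi ((x + y + (2 * ν - μ) * t) / Real.sqrt t) -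
        μ * Psi ((x + y + μ * t) / Real.sqrt t))

/-- The density `g(t;b,s)` of `(B_t^{-μ}, S_t^{-μ})`, vanishing off `{b ≤ s, 0 ≤ s}`. -/
noncomputable def gker (μ t b s : ℝ) : ℝ :=
  if b ≤ s ∧ 0 ≤ s then
    Real.sqrt (2 / Real.pi) * t ^ (-(3 : ℝ) / 2) * (2 * s - b) *
      Real.exp (-(2 * s - b) ^ 2 / (2 * t) - μ * (b + μ * t / 2))
  else 0

/-- Spatial derivative (one-sided at `x = 0`). -/
noncomputable def ux (u : ℝ → ℝ → ℝ) (t x : ℝ) : ℝ :=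
  derivWithin (fun z => u t z) (Set.Ici 0) x

/-- Second spatial derivative (one-sided at `x = 0`). -/
noncomputable def uxx (u : ℝ → ℝ → ℝ) (t x : ℝ) : ℝ :=
  derivWithin (fun z => ux u t z) (Set.Ici 0) x

/-- Time derivative. -/
noncomputable def ut (u : ℝ → ℝ → ℝ) (t x : ℝ) : ℝ :=
  deriv (fun s => u s x) t

/-- `u` is a solution of the Stroock–Williams problem with parameters `μ, ν`
and initial data `f`. -/
def IsSWSolution (μ ν : ℝ) (f : ℝ → ℝ) (u : ℝ → ℝ → ℝ) : Prop :=
  ContDiffOn ℝ (⊤ : ℕ∞) (fun p : ℝ × ℝ => u p.1 p.2) (Set.Ioi 0 ×ˢ Set.Ici 0) ∧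
  (∀ T > (0 : ℝ),
    ContinuousOn (fun p : ℝ × ℝ => u p.1 p.2) (Set.Icc 0 T ×ˢ Set.Ici 0) ∧
    ContinuousOn (fun p : ℝ × ℝ => ux u p.1 p.2) (Set.Icc 0 T ×ˢ Set.Ici 0) ∧
    ∃ C : ℝ, ∀ p ∈ Set.Icc (0 : ℝ) T ×ˢ Set.Ici (0 : ℝ),
      |u p.1 p.2| ≤ C ∧ |ux u p.1 p.2| ≤ C) ∧
  (∀ t > (0 : ℝ), Filter.Tendsto (fun x => u t x) Filter.atTop (nhds 0)) ∧
  (∀ t > (0 : ℝ), ∀ x ≥ (0 : ℝ), ut u t x = μ * ux u t x + (1 / 2) * uxx u t x) ∧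
  (∀ x ≥ (0 : ℝ), u 0 x = f x) ∧
  (∀ t > (0 : ℝ), ut u t 0 = ν * ux u t 0)

/-- `f` is admissible initial data: `C¹` on `[0,∞)` with `f` and `f'` bounded
and `f(x) → 0` as `x → ∞`. -/
def IsInitialData (f : ℝ → ℝ) : Prop :=
  ContDiffOn ℝ 1 f (Set.Ici 0) ∧
  (∃ C : ℝ, ∀ x ∈ Set.Ici (0 : ℝ), |f x| ≤ C ∧ |derivWithin f (Set.Ici 0) x| ≤ C) ∧
  Filter.Tendsto f Filter.atTop (nhds 0)

/-- A continuous function on the line of at most exponential growth. -/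
def ExpGrowth (F : ℝ → ℝ) : Prop :=
  Continuous F ∧ ∃ C A : ℝ, 0 ≤ C ∧ 0 ≤ A ∧ ∀ y, |F y| ≤ C * Real.exp (A * |y|)

namespace ExpGrowth

variable {F G : ℝ → ℝ}

theorem add (hF : ExpGrowth F) (hG : ExpGrowth G) : ExpGrowth (fun y => F y + G y) := by
  obtain ⟨hFc, C, A, hC, hA, h⟩ := hF
  obtain ⟨hGc, C', A', hC', hA', h'⟩ := hG
  refine ⟨hFc.add hGc, C + C', A + A', by positivity, by positivity, fun y => ?_⟩
  have h1 : Real.exp (A * |y|) ≤ Real.exp ((A + A') * |y|) :=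
    Real.exp_le_exp.2 (by nlinarith [mul_nonneg hA' (abs_nonneg y)])
  have h2 : Real.exp (A' * |y|) ≤ Real.exp ((A + A') * |y|) :=
    Real.exp_le_exp.2 (by nlinarith [mul_nonneg hA (abs_nonneg y)])
  calc |F y + G y| ≤ |F y| + |G y| := abs_add_le _ _
    _ ≤ C * Real.exp (A * |y|) + C' * Real.exp (A' * |y|) := add_le_add (h y) (h' y)
    _ ≤ C * Real.exp ((A + A') * |y|) + C' * Real.exp ((A + A') * |y|) := by gcongr
    _ = _ := by ring

theorem mul (hF : ExpGrowth F) (hG : ExpGrowth G) : ExpGrowth (fun y => F y * G y) := by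
  obtain ⟨hFc, C, A, hC, hA, h⟩ := hF
  obtain ⟨hGc, C', A', hC', hA', h'⟩ := hG
  refine ⟨hFc.mul hGc, C * C', A + A', by positivity, by positivity, fun y => ?_⟩
  rw [abs_mul, add_mul, Real.exp_add]
  calc |F y| * |G y| ≤ (C * Real.exp (A * |y|)) * (C' * Real.exp (A' * |y|)) :=
        mul_le_mul (h y) (h' y) (abs_nonneg _) (by positivity)
    _ = _ := by ring

theorem of_bounded (hF : Continuous F) {C : ℝ} (h : ∀ y, |F y| ≤ C) : ExpGrowth F :=
  ⟨hF, C, 0, (abs_nonneg _).trans (h 0), le_rfl, fun y => by simpa using h y⟩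

theorem const (c : ℝ) : ExpGrowth (fun _ => c) := of_bounded continuous_const fun _ => le_rfl

theorem const_mul (hF : ExpGrowth F) (c : ℝ) : ExpGrowth (fun y => c * F y) := (const c).mul hF

theorem exp_mul_abs (k : ℝ) : ExpGrowth (fun y => Real.exp (k * |y|)) := by
  refine ⟨by fun_prop, 1, |k|, zero_le_one, abs_nonneg _, fun y => ?_⟩
  rw [Real.abs_exp, one_mul, Real.exp_le_exp]
  exact mul_le_mul_of_nonneg_right (le_abs_self k) (abs_nonneg y)

theorem exp_mul (k : ℝ) : ExpGrowth (fun y => Real.exp (k * y)) := by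
  refine ⟨by fun_prop, 1, |k|, zero_le_one, abs_nonneg _, fun y => ?_⟩
  rw [Real.abs_exp, one_mul, Real.exp_le_exp, ← abs_mul]
  exact le_abs_self _

theorem id : ExpGrowth (fun y => y) :=
  ⟨continuous_id, 1, 1, zero_le_one, zero_le_one, fun y => by
    linarith [Real.add_one_le_exp |y|, one_mul |y|, one_mul (Real.exp (1 * |y|)),
      congrArg Real.exp (one_mul |y|)]⟩

theorem abs (hF : ExpGrowth F) : ExpGrowth (fun y => |F y|) := by
  obtain ⟨hFc, C, A, hC, hA, h⟩ := hF
  exact ⟨hFc.abs, C, A, hC, hA, fun y => by simpa using h y⟩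

theorem comp (hF : ExpGrowth F) {g : ℝ → ℝ} (hg : Continuous g) {B : ℝ}
    (h : ∀ y, |g y| ≤ |y| + B) : ExpGrowth (fun y => F (g y)) := by
  obtain ⟨hFc, C, A, hC, hA, hF⟩ := hF
  refine ⟨hFc.comp hg, C * Real.exp (A * B), A, by positivity, hA, fun y => ?_⟩
  calc |F (g y)| ≤ C * Real.exp (A * |g y|) := hF _
    _ ≤ C * Real.exp (A * (|y| + B)) := by gcongr; exact h y
    _ = _ := by rw [mul_add, Real.exp_add]; ring

theorem comp_const_add (hF : ExpGrowth F) (x : ℝ) : ExpGrowth (fun y => F (x + y)) :=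
  hF.comp (by fun_prop) (B := |x|) fun y => by linarith [abs_add_le x y]

theorem comp_const_sub (hF : ExpGrowth F) (x : ℝ) : ExpGrowth (fun y => F (x - y)) :=
  hF.comp (by fun_prop) (B := |x|) fun y => by linarith [abs_sub x y]

theorem primitive (hF : ExpGrowth F) : ExpGrowth (fun u => ∫ y in (0 : ℝ)..u, F y) := by
  have hc : Continuous (fun u => ∫ y in (0 : ℝ)..u, F y) :=
    continuous_iff_continuousAt.2 fun u =>
      (hF.1.integral_hasStrictDerivAt 0 u).hasDerivAt.continuousAt
  obtain ⟨hFc, C, A, hC, hA, h⟩ := hF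
  refine ⟨hc, C, A + 1, hC, by positivity, fun u => ?_⟩
  have h1 : ‖∫ y in (0 : ℝ)..u, F y‖ ≤ C * Real.exp (A * |u|) * |u - 0| := by
    refine intervalIntegral.norm_integral_le_of_norm_le_const fun y hy => ?_
    refine (h y).trans ?_
    have : |y| ≤ |u| := by
      rcases le_total 0 u with hu | hu
      · rw [uIoc_of_le hu] at hy
        rw [abs_of_pos hy.1, abs_of_nonneg hu]; exact hy.2
      · rw [uIoc_of_ge hu] at hy
        rw [abs_of_nonpos hy.2, abs_of_nonpos hu]; linarith [hy.1]
    gcongr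
  rw [sub_zero, Real.norm_eq_abs] at h1
  refine h1.trans ?_
  rw [add_mul, Real.exp_add, one_mul, mul_assoc]
  gcongr
  linarith [Real.add_one_le_exp |u|]

theorem integrable_mul_exp_sq (hF : ExpGrowth F) {a : ℝ} (ha : a < 0) :
    Integrable (fun y => F y * Real.exp (a * y ^ 2)) := by
  obtain ⟨hFc, C, A, hC, hA, h⟩ := hF
  have hI := (integrable_exp_neg_mul_sq (b := -a / 2) (by linarith)).const_mul
    (C * Real.exp (A ^ 2 / (-2 * a)))
  refine hI.mono' (by fun_prop) (ae_of_all _ fun y => ?_)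
  rw [Real.norm_eq_abs, abs_mul, Real.abs_exp]
  have key : A * |y| + a * y ^ 2 ≤ A ^ 2 / (-2 * a) + -(-a / 2) * y ^ 2 := by
    have h3 : 0 ≤ (-a * |y| - A) ^ 2 / (-2 * a) := div_nonneg (sq_nonneg _) (by linarith)
    have h4 : (-a * |y| - A) ^ 2 / (-2 * a) = A ^ 2 / (-2 * a) - A * |y| - a / 2 * |y| ^ 2 := by
      have ha' : a ≠ 0 := ha.ne
      field_simp
      ring
    rw [sq_abs] at h4
    linarith
  calc |F y| * Real.exp (a * y ^ 2) ≤ C * Real.exp (A * |y|) * Real.exp (a * y ^ 2) := by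
        gcongr; exact h y
    _ = C * Real.exp (A * |y| + a * y ^ 2) := by rw [Real.exp_add]; ring
    _ ≤ C * Real.exp (A ^ 2 / (-2 * a) + -(-a / 2) * y ^ 2) := by gcongr
    _ = _ := by rw [Real.exp_add]; ring

theorem integrable_mul_exp_quadratic (hF : ExpGrowth F) {a : ℝ} (ha : a < 0) (b : ℝ) :
    Integrable (fun y => F y * Real.exp (a * y ^ 2 + b * y)) := by
  refine ((hF.mul (exp_mul b)).integrable_mul_exp_sq ha).congr (ae_of_all _ fun y => ?_)
  simp only [Real.exp_add]
  ring

end ExpGrowth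

/-- Integration by parts against a centred Gaussian on the half-line. -/
theorem integral_Ioi_deriv_mul_exp_sq {M M' : ℝ → ℝ} (hM : ExpGrowth M) (hM' : ExpGrowth M')
    (hd : ∀ z, HasDerivAt M (M' z) z) (h0 : M 0 = 0) {a : ℝ} (ha : a < 0) :
    ∫ z in Ioi (0 : ℝ), M' z * Real.exp (a * z ^ 2) =
      -(2 * a) * ∫ z in Ioi (0 : ℝ), z * M z * Real.exp (a * z ^ 2) := by
  have hI1 := (hM'.integrable_mul_exp_sq ha).integrableOn (s := Ioi 0)
  have hI2 := (((ExpGrowth.id).mul hM).integrable_mul_exp_sq ha).integrableOn (s := Ioi 0)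
  have hI3 := (hM.integrable_mul_exp_sq ha).integrableOn (s := Ioi 0)
  have hder : ∀ z, HasDerivAt (fun z => M z * Real.exp (a * z ^ 2))
      (M' z * Real.exp (a * z ^ 2) + (2 * a) * (z * M z * Real.exp (a * z ^ 2))) z := by
    intro z
    have := (hd z).mul (((hasDerivAt_pow 2 z).const_mul a).exp)
    refine this.congr_deriv ?_
    simp
    ring
  have hI := hI1.add (hI2.const_mul (2 * a))
  have hlim := tendsto_zero_of_hasDerivAt_of_integrableOn_Ioi (fun z _ => hder z) hI hI3
  have := integral_Ioi_of_hasDerivAt_of_tendsto' (fun z _ => hder z) hI hlim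
  rw [integral_add hI1 (hI2.const_mul (2 * a)), integral_const_mul, h0] at this
  linarith

/-- The integral over the line as an integral over the half-line. -/
theorem integral_eq_integral_Ioi_add_neg {g : ℝ → ℝ} (hg : Integrable g) :
    ∫ y, g y = ∫ y in Ioi (0 : ℝ), (g y + g (-y)) := by
  rw [integral_add hg.integrableOn hg.comp_neg.integrableOn, integral_comp_neg_Ioi, neg_zero,
    add_comm, intervalIntegral.integral_Iic_add_Ioi hg.integrableOn hg.integrableOn]

/-- The two-parameter Gaussian moment integral of `F`. -/
noncomputable def gaussTransform (F : ℝ → ℝ) (p : ℝ × ℝ) : ℝ :=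
  ∫ y, F y * Real.exp (p.1 * y ^ 2 + p.2 * y)

theorem hasFDerivAt_gaussTransform {F : ℝ → ℝ} (hF : ExpGrowth F) {p : ℝ × ℝ} (hp : p.1 < 0) :
    HasFDerivAt (gaussTransform F)
      (gaussTransform (fun y => y * (y * F y)) p • ContinuousLinearMap.fst ℝ ℝ ℝ +
        gaussTransform (fun y => y * F y) p • ContinuousLinearMap.snd ℝ ℝ ℝ) p := by
  have hF1 : ExpGrowth (fun y => y * F y) := ExpGrowth.id.mul hF
  have hF2 : ExpGrowth (fun y => y * (y * F y)) := ExpGrowth.id.mul hF1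
  set D : ℝ × ℝ → ℝ → (ℝ × ℝ →L[ℝ] ℝ) := fun q y =>
    (y * (y * F y) * Real.exp (q.1 * y ^ 2 + q.2 * y)) • ContinuousLinearMap.fst ℝ ℝ ℝ +
      (y * F y * Real.exp (q.1 * y ^ 2 + q.2 * y)) • ContinuousLinearMap.snd ℝ ℝ ℝ with hD
  have hs : {q : ℝ × ℝ | q.1 < p.1 / 2 ∧ |q.2| < |p.2| + 1} ∈ nhds p := by
    refine IsOpen.mem_nhds (IsOpen.inter ?_ ?_) ⟨by linarith, by linarith⟩
    · exact isOpen_lt continuous_fst continuous_const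
    · exact isOpen_lt continuous_snd.abs continuous_const
  have hc := hF.1
  have hpos : p.1 / 2 < 0 := by linarith
  have key := hasFDerivAt_integral_of_dominated_of_fderiv_le (μ := volume) (𝕜 := ℝ)
    (F := fun (q : ℝ × ℝ) y => F y * Real.exp (q.1 * y ^ 2 + q.2 * y)) (F' := D) (x₀ := p)
    (bound := fun y => ((|y * (y * F y)| + |y * F y|) * Real.exp ((|p.2| + 1) * |y|)) *
      Real.exp (p.1 / 2 * y ^ 2)) hs
    (Eventually.of_forall fun q => by fun_prop)
    (hF.integrable_mul_exp_quadratic hp p.2)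
    (by rw [hD]; fun_prop)
    (ae_of_all _ fun y q hq => ?_)
    (((hF2.abs.add hF1.abs).mul (ExpGrowth.exp_mul_abs _)).integrable_mul_exp_sq hpos)
    (ae_of_all _ fun y q hq => ?_)
  · refine key.congr_fderiv ?_
    rw [hD, integral_add, integral_smul_const, integral_smul_const]
    · rfl
    · exact (hF2.integrable_mul_exp_quadratic hp p.2).smul_const _
    · exact (hF1.integrable_mul_exp_quadratic hp p.2).smul_const _
  · have hexp : Real.exp (q.1 * y ^ 2 + q.2 * y) ≤
        Real.exp ((|p.2| + 1) * |y|) * Real.exp (p.1 / 2 * y ^ 2) := by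
      rw [← Real.exp_add, Real.exp_le_exp]
      have h1 : q.1 * y ^ 2 ≤ p.1 / 2 * y ^ 2 := by nlinarith [sq_nonneg y, hq.1]
      have h2 : q.2 * y ≤ (|p.2| + 1) * |y| :=
        (le_abs_self _).trans (by rw [abs_mul]; gcongr; exact hq.2.le)
      linarith
    have hf : ‖ContinuousLinearMap.fst ℝ ℝ ℝ‖ ≤ 1 := ContinuousLinearMap.norm_fst_le ..
    have hsn : ‖ContinuousLinearMap.snd ℝ ℝ ℝ‖ ≤ 1 := ContinuousLinearMap.norm_snd_le ..
    calc ‖D q y‖ ≤ |y * (y * F y) * Real.exp (q.1 * y ^ 2 + q.2 * y)| * 1 +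
          |y * F y * Real.exp (q.1 * y ^ 2 + q.2 * y)| * 1 := by
          refine (norm_add_le _ _).trans ?_
          rw [norm_smul, norm_smul, Real.norm_eq_abs, Real.norm_eq_abs]
          gcongr
      _ = (|y * (y * F y)| + |y * F y|) * Real.exp (q.1 * y ^ 2 + q.2 * y) := by
          rw [abs_mul _ (Real.exp _), abs_mul _ (Real.exp _), Real.abs_exp]; ring
      _ ≤ (|y * (y * F y)| + |y * F y|) *
          (Real.exp ((|p.2| + 1) * |y|) * Real.exp (p.1 / 2 * y ^ 2)) := by gcongr
      _ = _ := by ring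
  · have h1 : HasFDerivAt (fun q : ℝ × ℝ => q.1 * y ^ 2 + q.2 * y)
        (y ^ 2 • ContinuousLinearMap.fst ℝ ℝ ℝ + y • ContinuousLinearMap.snd ℝ ℝ ℝ) q :=
      (hasFDerivAt_fst.mul_const (y ^ 2)).add (hasFDerivAt_snd.mul_const y)
    refine (h1.exp.const_mul (F y)).congr_fderiv ?_
    ext <;> simp [hD] <;> ring

theorem contDiffOn_gaussTransform {F : ℝ → ℝ} (hF : ExpGrowth F) :
    ContDiffOn ℝ (⊤ : ℕ∞) (gaussTransform F) {p | p.1 < 0} := by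
  have ho : IsOpen {p : ℝ × ℝ | p.1 < 0} := isOpen_lt continuous_fst continuous_const
  refine contDiffOn_infty.2 fun n => ?_
  induction n generalizing F with
  | zero =>
    exact contDiffOn_zero.2 fun p hp =>
      (hasFDerivAt_gaussTransform hF hp).continuousAt.continuousWithinAt
  | succ n ih =>
    have hF1 : ExpGrowth (fun y => y * F y) := ExpGrowth.id.mul hF
    have hF2 : ExpGrowth (fun y => y * (y * F y)) := ExpGrowth.id.mul hF1
    rw [Nat.cast_succ, contDiffOn_succ_iff_hasFDerivWithinAt_of_uniqueDiffOn ho.uniqueDiffOn]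
    refine ⟨fun h => by simp at h, _, ?_,
      fun p hp => (hasFDerivAt_gaussTransform hF hp).hasFDerivWithinAt⟩
    exact ((ih hF2).smul contDiffOn_const).add ((ih hF1).smul contDiffOn_const)

/-- The heat semigroup applied to `F`. -/
noncomputable def heat (F : ℝ → ℝ) (t x : ℝ) : ℝ :=
  (Real.sqrt (2 * Real.pi * t))⁻¹ * Real.exp (-x ^ 2 / (2 * t)) *
    gaussTransform F (-(2 * t)⁻¹, x / t)

theorem heat_eq_integral (F : ℝ → ℝ) {t : ℝ} (ht : 0 < t) (x : ℝ) :
    heat F t x = (Real.sqrt (2 * Real.pi * t))⁻¹ *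
      ∫ y, F (x + y) * Real.exp (-(2 * t)⁻¹ * y ^ 2) := by
  rw [heat, mul_assoc, gaussTransform, ← integral_const_mul,
    ← integral_add_left_eq_self (μ := volume) _ x]
  congr 1
  refine integral_congr_ae (ae_of_all _ fun y => ?_)
  simp only
  rw [mul_left_comm, ← Real.exp_add]
  congr 2
  field_simp
  ring

theorem contDiffOn_heat {F : ℝ → ℝ} (hF : ExpGrowth F) :
    ContDiffOn ℝ (⊤ : ℕ∞) (fun p : ℝ × ℝ => heat F p.1 p.2) {p | 0 < p.1} := by
  have hJ : ContDiffOn ℝ (⊤ : ℕ∞)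
      (fun p : ℝ × ℝ => gaussTransform F (-(2 * p.1)⁻¹, p.2 / p.1)) {p | 0 < p.1} := by
    have hne : ∀ p ∈ {p : ℝ × ℝ | 0 < p.1}, 2 * p.1 ≠ 0 := fun p hp =>
      (mul_pos two_pos (show 0 < p.1 from hp)).ne'
    refine (contDiffOn_gaussTransform hF).comp (ContDiffOn.prodMk ?_ ?_) fun p hp => ?_
    · exact ((contDiffOn_const.mul contDiffOn_fst).inv hne).neg
    · exact contDiffOn_snd.div contDiffOn_fst fun p hp => ne_of_gt hp
    · simpa using hp
  have h1 : ContDiffOn ℝ (⊤ : ℕ∞)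
      (fun p : ℝ × ℝ => (Real.sqrt (2 * Real.pi * p.1))⁻¹) {p | 0 < p.1} := by
    have hpos : ∀ p ∈ {p : ℝ × ℝ | 0 < p.1}, 0 < 2 * Real.pi * p.1 := fun p hp =>
      mul_pos (by positivity) hp
    exact ((contDiffOn_const.mul contDiffOn_fst).sqrt fun p hp => (hpos p hp).ne').inv
      fun p hp => (Real.sqrt_pos.2 (hpos p hp)).ne'
  have h2 : ContDiffOn ℝ (⊤ : ℕ∞)
      (fun p : ℝ × ℝ => Real.exp (-p.2 ^ 2 / (2 * p.1))) {p | 0 < p.1} :=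
    ((contDiffOn_snd.pow 2).neg.div (contDiffOn_const.mul contDiffOn_fst) fun p hp =>
      (mul_pos two_pos hp).ne').exp
  exact (h1.mul h2).mul hJ

theorem hasDerivAt_heat_space {F : ℝ → ℝ} (hF : ExpGrowth F) {t : ℝ} (ht : 0 < t) (x : ℝ) :
    HasDerivAt (fun x => heat F t x)
      (-(x / t) * heat F t x + t⁻¹ * heat (fun y => y * F y) t x) x := by
  have hp : ((-(2 * t)⁻¹, x / t) : ℝ × ℝ).1 < 0 := by simpa using ht
  have h1 : HasDerivAt (fun x : ℝ => ((-(2 * t)⁻¹, x / t) : ℝ × ℝ)) ((0, 1 / t) : ℝ × ℝ) x :=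
    (hasDerivAt_const x _).prodMk ((hasDerivAt_id x).div_const t)
  have h2 := (hasFDerivAt_gaussTransform hF hp).comp_hasDerivAt x h1
  have h3 : HasDerivAt (fun x : ℝ => -x ^ 2 / (2 * t)) (-(x / t)) x := by
    refine ((hasDerivAt_pow 2 x).neg.div_const (2 * t)).congr_deriv ?_
    field_simp
    simp
  refine ((h3.exp.const_mul (Real.sqrt (2 * Real.pi * t))⁻¹).mul h2).congr_deriv ?_
  simp [heat]
  ring

theorem hasDerivAt_heat_time {F : ℝ → ℝ} (hF : ExpGrowth F) {t : ℝ} (ht : 0 < t) (x : ℝ) :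
    HasDerivAt (fun t => heat F t x)
      ((-(2 * t)⁻¹ + x ^ 2 / (2 * t ^ 2)) * heat F t x - x / t ^ 2 * heat (fun y => y * F y) t x +
        (2 * t ^ 2)⁻¹ * heat (fun y => y * (y * F y)) t x) t := by
  have hp : ((-(2 * t)⁻¹, x / t) : ℝ × ℝ).1 < 0 := by simpa using ht
  have hinv : HasDerivAt (fun t : ℝ => (2 * t)⁻¹) (-(2 * t ^ 2)⁻¹) t := by
    refine (((hasDerivAt_id t).const_mul 2).inv (by simpa using ht.ne')).congr_deriv ?_
    simp
    field_simp
  have hdiv : HasDerivAt (fun t : ℝ => x / t) (-(x / t ^ 2)) t := by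
    refine ((hasDerivAt_inv ht.ne').const_mul x).congr_deriv ?_
    field_simp
  have h1 : HasDerivAt (fun t : ℝ => ((-(2 * t)⁻¹, x / t) : ℝ × ℝ))
      ((-(-(2 * t ^ 2)⁻¹), -(x / t ^ 2)) : ℝ × ℝ) t := hinv.neg.prodMk hdiv
  have h2 := (hasFDerivAt_gaussTransform hF hp).comp_hasDerivAt t h1
  have h3 : HasDerivAt (fun t : ℝ => -x ^ 2 / (2 * t)) (x ^ 2 / (2 * t ^ 2)) t := by
    refine (hinv.const_mul (-x ^ 2)).congr_deriv ?_
    field_simp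
  have hpos : 0 < 2 * Real.pi * t := by positivity
  have h4 : HasDerivAt (fun t : ℝ => (Real.sqrt (2 * Real.pi * t))⁻¹)
      (-(2 * t)⁻¹ * (Real.sqrt (2 * Real.pi * t))⁻¹) t := by
    refine ((((hasDerivAt_id t).const_mul (2 * Real.pi)).sqrt hpos.ne').inv
      (Real.sqrt_pos.2 hpos).ne').congr_deriv ?_
    simp only [_root_.id, mul_one]
    rw [Real.sq_sqrt hpos.le]
    have := (Real.sqrt_pos.2 hpos).ne'
    field_simp
  refine ((h4.mul h3.exp).mul h2).congr_deriv ?_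
  simp [heat]
  ring

theorem tendsto_heat {F : ℝ → ℝ} (hF : ExpGrowth F) (x : ℝ) :
    Tendsto (fun t => heat F t x) (nhdsWithin 0 (Ioi 0)) (nhds (F x)) := by
  obtain ⟨hFc, C, A, hC, hA, hb⟩ := hF
  have hform : ∀ t : ℝ, 0 < t → heat F t x = (Real.sqrt (2 * Real.pi))⁻¹ *
      ∫ z, F (x + Real.sqrt t * z) * Real.exp (-(1 / 2) * z ^ 2) := by
    intro t ht
    have hs := Real.sqrt_pos.2 ht
    have := Measure.integral_comp_mul_left
      (fun y => F (x + y) * Real.exp (-(2 * t)⁻¹ * y ^ 2)) (Real.sqrt t)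
    rw [heat_eq_integral F ht, Real.sqrt_mul (by positivity), mul_inv, mul_assoc]
    congr 1
    rw [abs_of_pos (inv_pos.2 hs), smul_eq_mul] at this
    rw [← this]
    refine integral_congr_ae (ae_of_all _ fun z => ?_)
    simp only
    rw [mul_pow, Real.sq_sqrt ht.le]
    congr 2
    field_simp
  have hlim : Tendsto (fun t => ∫ z, F (x + Real.sqrt t * z) * Real.exp (-(1 / 2) * z ^ 2))
      (nhdsWithin 0 (Ioi 0)) (nhds (∫ z, F x * Real.exp (-(1 / 2) * z ^ 2))) := by
    have hbd : ExpGrowth (fun z => C * Real.exp (A * |x|) * Real.exp (A * |z|)) :=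
      (ExpGrowth.exp_mul_abs A).const_mul _
    refine tendsto_integral_filter_of_dominated_convergence
      (fun z => C * Real.exp (A * |x|) * Real.exp (A * |z|) * Real.exp (-(1 / 2) * z ^ 2))
      (Eventually.of_forall fun t => by fun_prop) ?_
      (hbd.integrable_mul_exp_sq (by norm_num)) (ae_of_all _ fun z => ?_)
    · have h1 : ∀ᶠ t : ℝ in nhdsWithin 0 (Ioi 0), t < 1 :=
        eventually_nhdsWithin_of_eventually_nhds (eventually_lt_nhds one_pos)
      filter_upwards [h1] with t ht
      refine ae_of_all _ fun z => ?_
      rw [Real.norm_eq_abs, abs_mul, Real.abs_exp]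
      gcongr
      refine (hb _).trans ?_
      rw [mul_assoc, ← Real.exp_add, ← mul_add]
      have hs1 : Real.sqrt t ≤ 1 := Real.sqrt_le_one.2 ht.le
      have : |x + Real.sqrt t * z| ≤ |x| + |z| := by
        refine (abs_add_le _ _).trans ?_
        rw [abs_mul, abs_of_nonneg (Real.sqrt_nonneg t)]
        nlinarith [abs_nonneg z]
      gcongr
    · have hc : Continuous fun t => F (x + Real.sqrt t * z) * Real.exp (-(1 / 2) * z ^ 2) := by
        fun_prop
      have := hc.tendsto 0
      simp only [Real.sqrt_zero, zero_mul, add_zero] at this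
      exact this.mono_left nhdsWithin_le_nhds
  rw [integral_const_mul, integral_gaussian] at hlim
  have h2 := hlim.const_mul (Real.sqrt (2 * Real.pi))⁻¹
  have hpi : Real.pi / (1 / 2) = 2 * Real.pi := by ring
  have hne : Real.sqrt (2 * Real.pi) ≠ 0 := by positivity
  rw [hpi, mul_comm (F x), inv_mul_cancel_left₀ hne] at h2
  refine h2.congr' ?_
  filter_upwards [self_mem_nhdsWithin] with t ht
  exact (hform t ht).symm

/-- The solution `G` of `G' = f - κ G`, `G 0 = 0`. -/
noncomputable def expConv (κ : ℝ) (f : ℝ → ℝ) (u : ℝ) : ℝ :=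
  Real.exp (-κ * u) * ∫ y in (0 : ℝ)..u, f y * Real.exp (κ * y)

/-- The extension of `f` to the line for which the heat flow satisfies the Robin condition
`w' = κ w` at the origin. -/
noncomputable def robinExt (κ : ℝ) (f : ℝ → ℝ) (y : ℝ) : ℝ :=
  f |y| - 2 * κ * expConv κ f (max (-y) 0)

theorem expGrowth_expConv {f : ℝ → ℝ} (hf : ExpGrowth f) (κ : ℝ) : ExpGrowth (expConv κ f) :=
  (ExpGrowth.exp_mul (-κ)).mul (hf.mul (ExpGrowth.exp_mul κ)).primitive

theorem expConv_zero (κ : ℝ) (f : ℝ → ℝ) : expConv κ f 0 = 0 := by simp [expConv]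

theorem hasDerivAt_expConv {f : ℝ → ℝ} (hf : Continuous f) (κ u : ℝ) :
    HasDerivAt (expConv κ f) (f u - κ * expConv κ f u) u := by
  have h1 : Continuous fun y => f y * Real.exp (κ * y) := by fun_prop
  have h2 := (h1.integral_hasStrictDerivAt 0 u).hasDerivAt
  have h3 := ((hasDerivAt_id u).const_mul (-κ)).exp.mul h2
  refine h3.congr_deriv ?_
  have : Real.exp (-κ * u) * Real.exp (κ * u) = 1 := by rw [← Real.exp_add]; simp
  simp only [_root_.id, mul_one, expConv]
  linear_combination f u * this

theorem expGrowth_robinExt {f : ℝ → ℝ} (hf : ExpGrowth f) (κ : ℝ) : ExpGrowth (robinExt κ f) := by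
  have h1 : ExpGrowth fun y => f |y| := hf.comp (by fun_prop) (B := 0) fun y => by simp
  have h2 : ExpGrowth fun y => expConv κ f (max (-y) 0) :=
    (expGrowth_expConv hf κ).comp (by fun_prop) (B := 0) fun y => by
      rw [abs_of_nonneg (le_max_right _ _), add_zero]
      exact max_le (neg_le_abs y) (abs_nonneg y)
  have := h1.add (h2.const_mul (-(2 * κ)))
  convert this using 2
  rw [robinExt]
  ring

theorem robinExt_of_nonneg (κ : ℝ) (f : ℝ → ℝ) {y : ℝ} (hy : 0 ≤ y) : robinExt κ f y = f y := by
  rw [robinExt, abs_of_nonneg hy, max_eq_right (by linarith), expConv_zero]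
  ring

theorem robinExt_neg (κ : ℝ) (f : ℝ → ℝ) {u : ℝ} (hu : 0 ≤ u) :
    robinExt κ f (-u) = f u - 2 * κ * expConv κ f u := by
  rw [robinExt, abs_neg, abs_of_nonneg hu, neg_neg, max_eq_left hu]

theorem heat_robinExt_zero {f : ℝ → ℝ} (hf : ExpGrowth f) (κ : ℝ) {t : ℝ} (ht : 0 < t) :
    t⁻¹ * heat (fun y => y * robinExt κ f y) t 0 = κ * heat (robinExt κ f) t 0 := by
  have hF := expGrowth_robinExt hf κ
  have hG := expGrowth_expConv hf κ
  have ha : -(2 * t)⁻¹ < 0 := by simpa using ht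
  have hibp := integral_Ioi_deriv_mul_exp_sq (M := fun z => 2 * κ * expConv κ f z)
    (M' := fun z => 2 * κ * (f z + -κ * expConv κ f z)) (hG.const_mul _)
    ((hf.add (hG.const_mul _)).const_mul _)
    (fun z => ((hasDerivAt_expConv hf.1 κ z).const_mul (2 * κ)).congr_deriv (by ring))
    (by simp [expConv_zero]) ha
  rw [heat_eq_integral _ ht, heat_eq_integral _ ht]
  simp only [zero_add]
  rw [integral_eq_integral_Ioi_add_neg (hF.integrable_mul_exp_sq ha),
    integral_eq_integral_Ioi_add_neg ((ExpGrowth.id.mul hF).integrable_mul_exp_sq ha)]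
  have h1 : ∫ y in Ioi (0 : ℝ), (y * robinExt κ f y * Real.exp (-(2 * t)⁻¹ * y ^ 2) +
      -y * robinExt κ f (-y) * Real.exp (-(2 * t)⁻¹ * (-y) ^ 2)) =
      ∫ z in Ioi (0 : ℝ), z * (2 * κ * expConv κ f z) * Real.exp (-(2 * t)⁻¹ * z ^ 2) := by
    refine setIntegral_congr_fun measurableSet_Ioi fun y hy => ?_
    have hy' : 0 ≤ y := le_of_lt hy
    simp only [robinExt_neg κ f hy', robinExt_of_nonneg κ f hy', neg_sq]
    ring
  have h2 : ∫ z in Ioi (0 : ℝ), 2 * κ * (f z + -κ * expConv κ f z) *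
      Real.exp (-(2 * t)⁻¹ * z ^ 2) =
      κ * ∫ y in Ioi (0 : ℝ), (robinExt κ f y * Real.exp (-(2 * t)⁻¹ * y ^ 2) +
        robinExt κ f (-y) * Real.exp (-(2 * t)⁻¹ * (-y) ^ 2)) := by
    rw [← integral_const_mul]
    refine setIntegral_congr_fun measurableSet_Ioi fun y hy => ?_
    have hy' : 0 ≤ y := le_of_lt hy
    simp only [robinExt_neg κ f hy', robinExt_of_nonneg κ f hy', neg_sq]
    ring
  have h3 : -(2 * -(2 * t)⁻¹) = t⁻¹ := by field_simp
  rw [h3, h2] at hibp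
  rw [h1, mul_left_comm, ← hibp]
  ring

theorem integral_exp_mul_eq_integral_robinExt {f : ℝ → ℝ} (hf : Continuous f) (κ : ℝ) {x z : ℝ}
    (hF : Continuous (robinExt κ f)) (hx : 0 ≤ x) (hz : 0 ≤ z) :
    ∫ s in (0 : ℝ)..z, Real.exp (-κ * (max x s - x)) * f (max x s - 2 * s + z) =
      2⁻¹ * ∫ y in (x - z)..(x + z), robinExt κ f y := by
  have hθ : Continuous fun s => Real.exp (-κ * (max x s - x)) * f (max x s - 2 * s + z) := by
    fun_prop
  have hleft : ∀ u, 0 ≤ u → u ≤ x →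
      ∫ s in (0 : ℝ)..u, Real.exp (-κ * (max x s - x)) * f (max x s - 2 * s + z) =
        2⁻¹ * ∫ y in (x + z - 2 * u)..(x + z), f y := by
    intro u hu hux
    have := intervalIntegral.integral_comp_sub_mul (a := 0) (b := u) f two_ne_zero (x + z)
    rw [mul_zero, sub_zero, smul_eq_mul] at this
    rw [← this]
    refine intervalIntegral.integral_congr fun s hs => ?_
    rw [uIcc_of_le hu] at hs
    rw [max_eq_left (hs.2.trans hux), sub_self, mul_zero, Real.exp_zero, one_mul]
    congr 1
    ring
  have hcongr : ∀ u w, 0 ≤ u → u ≤ w → ∫ y in u..w, robinExt κ f y = ∫ y in u..w, f y := by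
    intro u w hu huw
    refine intervalIntegral.integral_congr fun y hy => ?_
    rw [uIcc_of_le huw] at hy
    exact robinExt_of_nonneg κ f (hu.trans hy.1)
  rcases le_total z x with hzx | hxz
  · rw [hleft z hz hzx, hcongr _ _ (by linarith) (by linarith)]
    congr 2
    ring
  · have hG := hasDerivAt_expConv hf κ
    have hright : ∫ s in x..z, Real.exp (-κ * (max x s - x)) * f (max x s - 2 * s + z) =
        expConv κ f (z - x) := by
      have := intervalIntegral.integral_comp_sub_left (a := x) (b := z)
        (fun r => f r * Real.exp (κ * r)) z
      rw [sub_self] at this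
      rw [expConv, ← this, ← intervalIntegral.integral_const_mul]
      refine intervalIntegral.integral_congr fun s hs => ?_
      rw [uIcc_of_le hxz] at hs
      rw [max_eq_right hs.1, mul_left_comm, ← Real.exp_add, mul_comm]
      congr 2 <;> ring
    have hneg : ∫ y in (x - z)..0, robinExt κ f y =
        2 * expConv κ f (z - x) - ∫ y in (0 : ℝ)..(z - x), f y := by
      have h1 := intervalIntegral.integral_comp_neg (a := 0) (b := z - x) (robinExt κ f)
      rw [neg_zero, neg_sub] at h1
      rw [← h1]
      have hGc : Continuous (expConv κ f) :=
        continuous_iff_continuousAt.2 fun u => (hG u).continuousAt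
      have h2 : ∫ u in (0 : ℝ)..(z - x), (f u - κ * expConv κ f u) = expConv κ f (z - x) := by
        rw [intervalIntegral.integral_eq_sub_of_hasDerivAt (fun u _ => hG u)
          ((by fun_prop : Continuous fun u => f u - κ * expConv κ f u).intervalIntegrable _ _),
          expConv_zero, sub_zero]
      rw [← h2, ← intervalIntegral.integral_const_mul, ← intervalIntegral.integral_sub
        ((by fun_prop : Continuous fun u => 2 * (f u - κ * expConv κ f u)).intervalIntegrable _ _)
        (hf.intervalIntegrable _ _)]
      refine intervalIntegral.integral_congr fun u hu => ?_
      rw [uIcc_of_le (by linarith)] at hu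
      simp only [robinExt_neg κ f hu.1]
      ring
    have h2x : x + z - 2 * x = z - x := by ring
    rw [← intervalIntegral.integral_add_adjacent_intervals (hθ.intervalIntegrable 0 x)
      (hθ.intervalIntegrable x z), hleft x hx le_rfl, hright, h2x,
      ← intervalIntegral.integral_add_adjacent_intervals (hF.intervalIntegrable (x - z) 0)
        (hF.intervalIntegrable 0 (x + z)), hneg, hcongr 0 (x + z) le_rfl (by linarith),
      ← intervalIntegral.integral_add_adjacent_intervals (hf.intervalIntegrable 0 (z - x))
        (hf.intervalIntegrable (z - x) (x + z))]
    ring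

theorem integrable_indicator_wedge {f : ℝ → ℝ} (hf : ExpGrowth f) (κ : ℝ) {t x : ℝ} (ht : 0 < t)
    (hx : 0 ≤ x) :
    Integrable ({p : ℝ × ℝ | 0 < p.1 ∧ p.1 ≤ p.2}.indicator fun p =>
      Real.exp (-κ * (max x p.1 - x)) * f (max x p.1 - 2 * p.1 + p.2) *
        (p.2 * Real.exp (-(2 * t)⁻¹ * p.2 ^ 2))) (volume.prod volume) := by
  obtain ⟨hfc, C, A, hC, hA, hb⟩ := hf
  have hneg : -(4 * t)⁻¹ < 0 := by simpa using ht
  have hS : MeasurableSet {p : ℝ × ℝ | 0 < p.1 ∧ p.1 ≤ p.2} :=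
    (measurableSet_lt measurable_const measurable_fst).inter
      (measurableSet_le measurable_fst measurable_snd)
  have h1 : Integrable fun s : ℝ => 1 * Real.exp (-(4 * t)⁻¹ * s ^ 2) :=
    (ExpGrowth.const 1).integrable_mul_exp_sq hneg
  have h2 : Integrable fun z : ℝ => Real.exp (|κ| * |z|) *
      (C * Real.exp (A * x) * Real.exp (A * |z|)) * |z| * Real.exp (-(4 * t)⁻¹ * z ^ 2) :=
    (((ExpGrowth.exp_mul_abs |κ|).mul ((ExpGrowth.exp_mul_abs A).const_mul
      (C * Real.exp (A * x)))).mul ExpGrowth.id.abs).integrable_mul_exp_sq hneg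
  refine (h1.mul_prod h2).mono' ?_ (ae_of_all _ fun p => ?_)
  · exact (Continuous.aestronglyMeasurable (by fun_prop)).indicator hS
  · by_cases hp : p ∈ {p : ℝ × ℝ | 0 < p.1 ∧ p.1 ≤ p.2}
    · rw [indicator_of_mem hp, Real.norm_eq_abs, abs_mul, abs_mul, abs_mul, Real.abs_exp,
        Real.abs_exp]
      obtain ⟨hp1, hp2⟩ := hp
      have hz : 0 ≤ p.2 := hp1.le.trans hp2
      have hm1 : 0 ≤ max x p.1 - x := sub_nonneg.2 (le_max_left _ _)
      have hm2 : max x p.1 ≤ x + p.1 := max_le (by linarith) (by linarith)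
      have e1 : Real.exp (-κ * (max x p.1 - x)) ≤ Real.exp (|κ| * |p.2|) := by
        rw [Real.exp_le_exp]
        refine mul_le_mul (neg_le_abs κ) ?_ hm1 (abs_nonneg κ)
        rw [abs_of_nonneg hz]
        linarith
      have e2 : |f (max x p.1 - 2 * p.1 + p.2)| ≤
          C * Real.exp (A * x) * Real.exp (A * |p.2|) := by
        refine (hb _).trans ?_
        rw [mul_assoc, ← Real.exp_add, ← mul_add, abs_of_nonneg hz, abs_of_nonneg]
        · gcongr
          linarith
        · linarith [le_max_right x p.1]
      have e3 : Real.exp (-(2 * t)⁻¹ * p.2 ^ 2) ≤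
          Real.exp (-(4 * t)⁻¹ * p.1 ^ 2) * Real.exp (-(4 * t)⁻¹ * p.2 ^ 2) := by
        rw [← Real.exp_add, Real.exp_le_exp]
        have h5 : p.1 ^ 2 ≤ p.2 ^ 2 := by gcongr
        have h6 : (2 * t)⁻¹ = 2 * (4 * t)⁻¹ := by field_simp; norm_num
        have h7 : 0 < (4 * t)⁻¹ := by positivity
        rw [h6]
        nlinarith
      calc _ ≤ Real.exp (|κ| * |p.2|) * (C * Real.exp (A * x) * Real.exp (A * |p.2|)) *
            (|p.2| * (Real.exp (-(4 * t)⁻¹ * p.1 ^ 2) * Real.exp (-(4 * t)⁻¹ * p.2 ^ 2))) := by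
            gcongr
        _ = _ := by ring
    · rw [indicator_of_notMem hp, norm_zero]
      positivity

theorem integral_wedge_eq_heat {f : ℝ → ℝ} (hf : ExpGrowth f) (κ : ℝ) {t x : ℝ} (ht : 0 < t)
    (hx : 0 ≤ x) :
    ∫ s, ∫ z, {p : ℝ × ℝ | 0 < p.1 ∧ p.1 ≤ p.2}.indicator (fun p =>
      Real.exp (-κ * (max x p.1 - x)) * f (max x p.1 - 2 * p.1 + p.2) *
        (p.2 * Real.exp (-(2 * t)⁻¹ * p.2 ^ 2))) (s, z) =
      t / 2 * (Real.sqrt (2 * Real.pi * t) * heat (robinExt κ f) t x) := by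
  have hF := expGrowth_robinExt hf κ
  have hP := hF.primitive
  have hneg : -(2 * t)⁻¹ < 0 := by simpa using ht
  rw [integral_integral_swap (f := fun s z => {p : ℝ × ℝ | 0 < p.1 ∧ p.1 ≤ p.2}.indicator (fun p =>
      Real.exp (-κ * (max x p.1 - x)) * f (max x p.1 - 2 * p.1 + p.2) *
        (p.2 * Real.exp (-(2 * t)⁻¹ * p.2 ^ 2))) (s, z)) (integrable_indicator_wedge hf κ ht hx)]
  set P : ℝ → ℝ := fun u => ∫ y in (0 : ℝ)..u, robinExt κ f y with hPdef
  have hPd : ∀ u, HasDerivAt P (robinExt κ f u) u := fun u =>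
    (hF.1.integral_hasStrictDerivAt 0 u).hasDerivAt
  have hibp := integral_Ioi_deriv_mul_exp_sq
    (M := fun z => 2⁻¹ * (P (x + z) + -1 * P (x - z)))
    (M' := fun z => 2⁻¹ * (robinExt κ f (x + z) + robinExt κ f (x - z)))
    (((hP.comp_const_add x).add ((hP.comp_const_sub x).const_mul (-1))).const_mul _)
    (((hF.comp_const_add x).add (hF.comp_const_sub x)).const_mul _)
    (fun z => by
      have h1 := (hPd (x + z)).comp_const_add x z
      have h2 := (hPd (x - z)).comp_const_sub x z
      exact ((h1.add (h2.const_mul (-1))).const_mul _).congr_deriv (by ring))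
    (by simp) hneg
  have hslice : ∀ z, ∫ s, {p : ℝ × ℝ | 0 < p.1 ∧ p.1 ≤ p.2}.indicator (fun p =>
      Real.exp (-κ * (max x p.1 - x)) * f (max x p.1 - 2 * p.1 + p.2) *
        (p.2 * Real.exp (-(2 * t)⁻¹ * p.2 ^ 2))) (s, z) =
      (Ioi (0 : ℝ)).indicator (fun z => z * (2⁻¹ * (P (x + z) + -1 * P (x - z))) *
        Real.exp (-(2 * t)⁻¹ * z ^ 2)) z := by
    intro z
    by_cases hz : 0 < z
    · have h1 : ∀ s, {p : ℝ × ℝ | 0 < p.1 ∧ p.1 ≤ p.2}.indicator (fun p =>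
          Real.exp (-κ * (max x p.1 - x)) * f (max x p.1 - 2 * p.1 + p.2) *
            (p.2 * Real.exp (-(2 * t)⁻¹ * p.2 ^ 2))) (s, z) =
          (Ioc 0 z).indicator (fun s => Real.exp (-κ * (max x s - x)) *
            f (max x s - 2 * s + z) * (z * Real.exp (-(2 * t)⁻¹ * z ^ 2))) s := fun s => rfl
      have h2 : (∫ y in (x - z)..(x + z), robinExt κ f y) = P (x + z) - P (x - z) :=
        (intervalIntegral.integral_interval_sub_left (hF.1.intervalIntegrable _ _)
          (hF.1.intervalIntegrable _ _)).symm
      simp_rw [h1]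
      rw [integral_indicator measurableSet_Ioc, integral_mul_const,
        ← intervalIntegral.integral_of_le hz.le,
        integral_exp_mul_eq_integral_robinExt hf.1 κ hF.1 hx hz.le,
        indicator_of_mem (mem_Ioi.2 hz), h2]
      ring
    · rw [indicator_of_notMem (by simpa using hz)]
      refine integral_eq_zero_of_ae (ae_of_all _ fun s => ?_)
      refine indicator_of_notMem (fun hp => hz ?_) _
      exact hp.1.trans_le hp.2
  have h3 : -(2 * -(2 * t)⁻¹) = t⁻¹ := by field_simp
  have h4 : ∫ z in Ioi (0 : ℝ), 2⁻¹ * (robinExt κ f (x + z) + robinExt κ f (x - z)) *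
      Real.exp (-(2 * t)⁻¹ * z ^ 2) =
      2⁻¹ * ∫ y, robinExt κ f (x + y) * Real.exp (-(2 * t)⁻¹ * y ^ 2) := by
    rw [integral_eq_integral_Ioi_add_neg ((hF.comp_const_add x).integrable_mul_exp_sq hneg),
      ← integral_const_mul]
    refine integral_congr_ae (ae_of_all _ fun z => ?_)
    simp only [neg_sq, ← sub_eq_add_neg]
    ring
  simp_rw [hslice]
  rw [integral_indicator measurableSet_Ioi]
  rw [h3, h4] at hibp
  have hs : Real.sqrt (2 * Real.pi * t) ≠ 0 := by positivity
  rw [heat_eq_integral _ ht, mul_inv_cancel_left₀ hs]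
  field_simp at hibp ⊢
  linarith

theorem integral_gker_eq_heat (μ ν : ℝ) {h H : ℝ → ℝ} (hH : Continuous H) {C : ℝ}
    (hC : ∀ y, |H y| ≤ C) (hhH : ∀ y, 0 ≤ y → h y = H y) {t x : ℝ} (ht : 0 < t) (hx : 0 ≤ x) :
    ∫ s in Ioi (0 : ℝ), ∫ b in Iic s,
        Real.exp (-(2 * (ν - μ)) * (max x s - x)) * h (max x s - b) * gker μ t b s =
      Real.exp (-μ * x - μ ^ 2 * t / 2) *
        heat (robinExt (2 * (ν - μ) + μ) fun y => H y * Real.exp (μ * y)) t x := by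
  set κ := 2 * (ν - μ) + μ with hκ
  set f : ℝ → ℝ := fun y => H y * Real.exp (μ * y) with hf
  have hfg : ExpGrowth f := (ExpGrowth.of_bounded hH hC).mul (ExpGrowth.exp_mul μ)
  set c : ℝ := Real.sqrt (2 / Real.pi) * t ^ (-(3 : ℝ) / 2) *
    Real.exp (-μ * x - μ ^ 2 * t / 2) with hc
  set K : ℝ × ℝ → ℝ := {p : ℝ × ℝ | 0 < p.1 ∧ p.1 ≤ p.2}.indicator fun p =>
      Real.exp (-κ * (max x p.1 - x)) * f (max x p.1 - 2 * p.1 + p.2) *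
        (p.2 * Real.exp (-(2 * t)⁻¹ * p.2 ^ 2)) with hK
  have hinner : ∀ s, 0 < s → ∫ b in Iic s,
      Real.exp (-(2 * (ν - μ)) * (max x s - x)) * h (max x s - b) * gker μ t b s =
      c * ∫ z, K (s, z) := by
    intro s hs
    rw [← integral_indicator measurableSet_Iic, ← integral_sub_left_eq_self _ _ (2 * s),
      ← integral_const_mul]
    refine integral_congr_ae (ae_of_all _ fun z => ?_)
    simp only
    by_cases hz : s ≤ z
    · have hm := le_max_right x s
      rw [indicator_of_mem (mem_Iic.2 (by linarith)), hK,
        indicator_of_mem (show (s, z) ∈ {p : ℝ × ℝ | 0 < p.1 ∧ p.1 ≤ p.2} from ⟨hs, hz⟩), gker,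
        if_pos ⟨by linarith, hs.le⟩, hhH _ (by linarith), hc, hf]
      have e1 : max x s - (2 * s - z) = max x s - 2 * s + z := by ring
      have e2 : 2 * s - (2 * s - z) = z := by ring
      simp only [e1, e2]
      have e3 : Real.exp (-(2 * (ν - μ)) * (max x s - x)) *
          Real.exp (-z ^ 2 / (2 * t) - μ * (2 * s - z + μ * t / 2)) =
          Real.exp (-μ * x - μ ^ 2 * t / 2) * (Real.exp (-κ * (max x s - x)) *
            Real.exp (μ * (max x s - 2 * s + z)) * Real.exp (-(2 * t)⁻¹ * z ^ 2)) := by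
        simp only [← Real.exp_add]
        congr 1
        rw [hκ]
        field_simp
        ring
      linear_combination H (max x s - 2 * s + z) * Real.sqrt (2 / Real.pi) *
        t ^ (-(3 : ℝ) / 2) * z * e3
    · rw [indicator_of_notMem (by simp only [mem_Iic]; linarith), hK,
        indicator_of_notMem (fun hp => hz hp.2), mul_zero]
  have houter : ∫ s in Ioi (0 : ℝ), ∫ z, K (s, z) = ∫ s, ∫ z, K (s, z) := by
    refine setIntegral_eq_integral_of_forall_compl_eq_zero fun s hs => ?_
    exact integral_eq_zero_of_ae (ae_of_all _ fun z => indicator_of_notMem (fun hp => hs hp.1) _)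
  rw [setIntegral_congr_fun measurableSet_Ioi fun s hs => hinner s hs, integral_const_mul, houter,
    hK, integral_wedge_eq_heat hfg κ ht hx, hc]
  have hconst : Real.sqrt (2 / Real.pi) * t ^ (-(3 : ℝ) / 2) *
      (t / 2 * Real.sqrt (2 * Real.pi * t)) = 1 := by
    have h1 : t ^ (-(3 : ℝ) / 2) * t * Real.sqrt t = 1 := by
      rw [Real.sqrt_eq_rpow]
      nth_rewrite 2 [← Real.rpow_one t]
      rw [← Real.rpow_add ht, ← Real.rpow_add ht]
      norm_num
    have h2 : Real.sqrt (2 / Real.pi) * Real.sqrt (2 * Real.pi) = 2 := by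
      rw [← Real.sqrt_mul (by positivity)]
      have : 2 / Real.pi * (2 * Real.pi) = 2 ^ 2 := by field_simp
      rw [this, Real.sqrt_sq zero_le_two]
    rw [Real.sqrt_mul (by positivity)]
    linear_combination h1 + 2⁻¹ * (t ^ (-(3 : ℝ) / 2) * t * Real.sqrt t) * h2
  linear_combination Real.exp (-μ * x - μ ^ 2 * t / 2) * heat (robinExt κ f) t x * hconst

/-- the elastic-killing functional of reflecting Brownian motion
solves the equation with the elastic boundary condition `v_x(t,0) = λ v(t,0)`. -/
theorem elastic_functional_solves (μ ν : ℝ) (h : ℝ → ℝ)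
    (hc : ContinuousOn h (Set.Ici 0)) (hb : ∃ C : ℝ, ∀ x ≥ (0 : ℝ), |h x| ≤ C)
    (v : ℝ → ℝ → ℝ)
    (hv0 : ∀ x ≥ (0 : ℝ), v 0 x = h x)
    (hvdef : ∀ t > (0 : ℝ), ∀ x ≥ (0 : ℝ),
      v t x = ∫ s in Set.Ioi (0 : ℝ), ∫ b in Set.Iic s,
        Real.exp (-(2 * (ν - μ)) * (max x s - x)) * h (max x s - b) *
          gker μ t b s) :
    ContDiffOn ℝ (⊤ : ℕ∞) (fun p : ℝ × ℝ => v p.1 p.2) (Set.Ioi 0 ×ˢ Set.Ici 0) ∧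
    (∀ t > (0 : ℝ), ∀ x ≥ (0 : ℝ),
      ut v t x = μ * ux v t x + (1 / 2) * uxx v t x) ∧
    (∀ t > (0 : ℝ), ux v t 0 = 2 * (ν - μ) * v t 0) ∧
    (∀ x ≥ (0 : ℝ),
      Filter.Tendsto (fun t => v t x) (nhdsWithin 0 (Set.Ioi 0)) (nhds (h x))) := by
  obtain ⟨C, hC⟩ := hb
  set H : ℝ → ℝ := fun y => h (max y 0) with hHdef
  have hH : Continuous H := hc.comp_continuous (by fun_prop) fun y => le_max_right y 0
  have hHC : ∀ y, |H y| ≤ C := fun y => hC _ (le_max_right y 0)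
  have hhH : ∀ y, 0 ≤ y → h y = H y := fun y hy => by rw [hHdef]; simp only [max_eq_left hy]
  set κ := 2 * (ν - μ) + μ with hκ
  have hf : ExpGrowth fun y => H y * Real.exp (μ * y) :=
    (ExpGrowth.of_bounded hH hHC).mul (ExpGrowth.exp_mul μ)
  set F := robinExt κ fun y => H y * Real.exp (μ * y) with hFdef
  have hF : ExpGrowth F := expGrowth_robinExt hf κ
  have hF1 : ExpGrowth fun y => y * F y := ExpGrowth.id.mul hF
  have hv : ∀ t > 0, ∀ x ≥ 0, v t x = Real.exp (-μ * x - μ ^ 2 * t / 2) * heat F t x :=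
    fun t ht x hx => (hvdef t ht x hx).trans (integral_gker_eq_heat μ ν hH hHC hhH ht hx)
  have hE : ∀ t x, HasDerivAt (fun x => Real.exp (-μ * x - μ ^ 2 * t / 2))
      (-μ * Real.exp (-μ * x - μ ^ 2 * t / 2)) x := fun t x => by
    refine (((hasDerivAt_id x).const_mul (-μ)).sub_const _).exp.congr_deriv ?_
    simp only [id, mul_one]
    ring
  have hux : ∀ t > 0, ∀ x ≥ 0, ux v t x = Real.exp (-μ * x - μ ^ 2 * t / 2) *
      ((-μ - x / t) * heat F t x + t⁻¹ * heat (fun y => y * F y) t x) := by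
    intro t ht x hx
    have h1 := (hE t x).mul (hasDerivAt_heat_space hF ht x)
    rw [ux, derivWithin_congr (s := Ici 0) (fun z hz => hv t ht z hz) (hv t ht x hx)]
    refine (h1.hasDerivWithinAt.derivWithin (uniqueDiffOn_Ici 0 x hx)).trans ?_
    ring
  have huxx : ∀ t > 0, ∀ x ≥ 0, uxx v t x = Real.exp (-μ * x - μ ^ 2 * t / 2) *
      (((μ + x / t) ^ 2 - t⁻¹) * heat F t x
        - 2 * (μ + x / t) * t⁻¹ * heat (fun y => y * F y) t x
        + (t ^ 2)⁻¹ * heat (fun y => y * (y * F y)) t x) := by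
    intro t ht x hx
    have h0 : HasDerivAt (fun x : ℝ => -μ - x / t) (-(1 / t)) x :=
      ((hasDerivAt_id x).div_const t).const_sub (-μ)
    have h1 := (hE t x).mul ((h0.mul (hasDerivAt_heat_space hF ht x)).add
      ((hasDerivAt_heat_space hF1 ht x).const_mul t⁻¹))
    rw [uxx, derivWithin_congr (s := Ici 0) (fun z hz => hux t ht z hz) (hux t ht x hx)]
    refine (h1.hasDerivWithinAt.derivWithin (uniqueDiffOn_Ici 0 x hx)).trans ?_
    simp only [Pi.mul_apply, Pi.add_apply]
    field_simp
    ring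
  refine ⟨?_, ?_, ?_, ?_⟩
  · have h1 : ContDiffOn ℝ (⊤ : ℕ∞)
        (fun p : ℝ × ℝ => Real.exp (-μ * p.2 - μ ^ 2 * p.1 / 2) * heat F p.1 p.2)
        {p | 0 < p.1} := by
      refine ContDiffOn.mul (ContDiff.contDiffOn ?_) (contDiffOn_heat hF)
      fun_prop
    exact (h1.mono fun p hp => hp.1).congr fun p hp => hv p.1 hp.1 p.2 hp.2
  · intro t ht x hx
    have h0 : HasDerivAt (fun t => Real.exp (-μ * x - μ ^ 2 * t / 2))
        (-(μ ^ 2 / 2) * Real.exp (-μ * x - μ ^ 2 * t / 2)) t := by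
      refine ((((hasDerivAt_id t).const_mul (μ ^ 2)).div_const 2).const_sub _).exp.congr_deriv ?_
      simp only [id, mul_one]
      ring
    have h1 := h0.mul (hasDerivAt_heat_time hF ht x)
    have h2 : (fun s => v s x) =ᶠ[nhds t]
        fun s => Real.exp (-μ * x - μ ^ 2 * s / 2) * heat F s x := by
      filter_upwards [lt_mem_nhds ht] with s hs using hv s hs x hx
    rw [hux t ht x hx, huxx t ht x hx, ut, h2.deriv_eq]
    refine h1.deriv.trans ?_
    field_simp
    ring
  · intro t ht
    rw [hux t ht 0 le_rfl, hv t ht 0 le_rfl, heat_robinExt_zero hf κ ht, hκ]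
    ring
  · intro x hx
    have h1 : Continuous fun t => Real.exp (-μ * x - μ ^ 2 * t / 2) := by fun_prop
    have h2 := ((h1.tendsto 0).mono_left nhdsWithin_le_nhds).mul (tendsto_heat hF x)
    have h3 : Real.exp (-μ * x - μ ^ 2 * 0 / 2) * F x = h x := by
      rw [hFdef, robinExt_of_nonneg κ _ hx, hhH x hx, mul_left_comm, ← Real.exp_add]
      simp
    rw [h3] at h2
    refine h2.congr' ?_
    filter_upwards [self_mem_nhdsWithin] with t ht
    exact (hv t ht x hx).symm
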